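/- Let q be an odd prime power, m ≥ 2, and let e⁽¹⁾ = (1,0,…,0) ∈ F_q^m. Let A(m,q) be the number of vectors v ∈ F_q^m \ {0, e⁽¹⁾} such that both ∑_{i=1}^m v_i² and (v₁−1)² + ∑_{i=2}^m v_i² are squares in F_q. Then A(m,q) = [q^{m−2}(q+1)² + (−1)^{((m−1)/2)·((q−1)/2)} · q^{(m−3)/2} · (3q² − 2q − 1)]/4 − 2 for m odd (m ≥ 3), and A(m,q) = [q^{m−2}(q+1)² + 2·(−1)^{(m/2)·((q−1)/2)} · q^{(m−2)/2} · (q−1)]/4 − 2 for m even. -/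

import Mathlib

open Finset

/-- The first standard unit vector in `F^m`. -/
def unitVec (F : Type) [Field F] (m : ℕ) : Fin m → F :=
  fun i => if (i : ℕ) = 0 then 1 else 0

section QuadraticSums

variable {F : Type*} [Field F] [Fintype F] [DecidableEq F]

/-- Summing over squares amounts to weighting each element by its number of square roots. -/
theorem sum_comp_sq (hF : ringChar F ≠ 2) (g : F → ℤ) :
    ∑ x : F, g (x ^ 2) = ∑ c : F, (1 + quadraticChar F c) * g c := by
  have h : ∀ c : F, ∑ x : F with x ^ 2 = c, g (x ^ 2) = (1 + quadraticChar F c) * g c := by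
    intro c
    rw [Finset.sum_congr rfl (g := fun _ => g c) (by simp +contextual), Finset.sum_const,
      nsmul_eq_mul, add_comm, ← quadraticChar_card_sqrts hF c]
    congr 3
    ext x
    simp
  rw [← Finset.sum_fiberwise Finset.univ (fun x : F => x ^ 2)]
  exact Finset.sum_congr rfl fun c _ => h c

theorem sum_quadraticChar_sq_sub (hF : ringChar F ≠ 2) (d : F) :
    ∑ x : F, quadraticChar F (x ^ 2 - d) =
      Fintype.card F * (if d = 0 then 1 else 0) - 1 := by
  have h0 : ∑ b : F, quadraticChar F b = 0 := quadraticChar_sum_zero hF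
  split_ifs with hd
  · subst hd
    have h : ∀ x : F, quadraticChar F (x ^ 2 - 0) = 1 - if x = 0 then 1 else 0 := by
      intro x
      split_ifs with hx
      · simp [hx]
      · simp [quadraticChar_sq_one' hx]
    simp_rw [h, Finset.sum_sub_distrib]
    simp
  · rw [sum_comp_sq hF fun c => quadraticChar F (c - d)]
    have h1 : ∑ c : F, quadraticChar F (c - d) = 0 := by
      rw [← h0]
      exact (Equiv.subRight d).sum_comp fun b => quadraticChar F b
    have h2 : ∀ c : F, quadraticChar F c * quadraticChar F (c - d) =
        quadraticChar F (1 - d * c⁻¹) - if c = 0 then 1 else 0 := by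
      intro c
      split_ifs with hc
      · simp [hc]
      · have : c * (c - d) = c ^ 2 * (1 - d * c⁻¹) := by field_simp
        rw [← map_mul, this, map_mul, quadraticChar_sq_one' hc]
        simp
    have h3 : ∑ c : F, quadraticChar F (1 - d * c⁻¹) = 0 := by
      rw [← h0]
      exact (((Equiv.inv F).trans (Equiv.mulLeft₀ d hd)).trans (Equiv.subLeft 1)).sum_comp
        fun b => quadraticChar F b
    simp_rw [add_mul, one_mul, Finset.sum_add_distrib, h1, h2, Finset.sum_sub_distrib, h3]
    simp

theorem sum_quadraticChar_sub_sq (hF : ringChar F ≠ 2) (d : F) :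
    ∑ x : F, quadraticChar F (d - x ^ 2) =
      quadraticChar F (-1) * (Fintype.card F * (if d = 0 then 1 else 0) - 1) := by
  rw [← sum_quadraticChar_sq_sub hF d, Finset.mul_sum]
  refine Finset.sum_congr rfl fun x _ => ?_
  rw [← map_mul]
  congr 1
  ring

omit [DecidableEq F] in
theorem sum_sum_sq_add (g : F → ℤ) :
    ∑ x : F, ∑ c : F, g (x ^ 2 + c) = Fintype.card F * ∑ c : F, g c := by
  have h : ∀ x : F, ∑ c : F, g (x ^ 2 + c) = ∑ c : F, g c := fun x =>
    Equiv.sum_comp (Equiv.addLeft (x ^ 2)) g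
  simp [h]

omit [DecidableEq F] in
theorem sum_pi_fin_succ_sq (n : ℕ) (g : F → ℤ) :
    ∑ w : Fin (n + 1) → F, g (∑ i, w i ^ 2) =
      ∑ x : F, ∑ w : Fin n → F, g (x ^ 2 + ∑ i, w i ^ 2) := by
  rw [← (Fin.consEquiv fun _ : Fin (n + 1) => F).sum_comp, Fintype.sum_prod_type]
  simp [Fin.consEquiv, Fin.sum_univ_succ]

/-- Sums of a function of `∑ wᵢ²`, in an odd and in an even positive number of variables. -/
theorem sum_comp_sum_sq (hF : ringChar F ≠ 2) (k : ℕ) :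
    (∀ g : F → ℤ, ∑ w : Fin (2 * k + 1) → F, g (∑ i, w i ^ 2) =
      Fintype.card F ^ (2 * k) * ∑ c : F, g c +
        Fintype.card F ^ k * quadraticChar F (-1) ^ k * ∑ c : F, quadraticChar F c * g c) ∧
    (∀ g : F → ℤ, ∑ w : Fin (2 * k + 2) → F, g (∑ i, w i ^ 2) =
      Fintype.card F ^ (2 * k + 1) * ∑ c : F, g c +
        Fintype.card F ^ k * quadraticChar F (-1) ^ (k + 1) *
          (Fintype.card F * g 0 - ∑ c : F, g c)) := by
  have even_of_odd : ∀ k : ℕ, (∀ g : F → ℤ, ∑ w : Fin (2 * k + 1) → F, g (∑ i, w i ^ 2) =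
      Fintype.card F ^ (2 * k) * ∑ c : F, g c +
        Fintype.card F ^ k * quadraticChar F (-1) ^ k * ∑ c : F, quadraticChar F c * g c) →
    (∀ g : F → ℤ, ∑ w : Fin (2 * k + 2) → F, g (∑ i, w i ^ 2) =
      Fintype.card F ^ (2 * k + 1) * ∑ c : F, g c +
        Fintype.card F ^ k * quadraticChar F (-1) ^ (k + 1) *
          (Fintype.card F * g 0 - ∑ c : F, g c)) := by
    intro k ih g
    have h : ∑ x : F, ∑ c : F, quadraticChar F c * g (x ^ 2 + c) =
        quadraticChar F (-1) * (Fintype.card F * g 0 - ∑ c : F, g c) := by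
      have h1 : ∀ x : F, ∑ c : F, quadraticChar F c * g (x ^ 2 + c) =
          ∑ d : F, quadraticChar F (d - x ^ 2) * g d := fun x => by
        rw [← Equiv.sum_comp (Equiv.addLeft (x ^ 2)) fun d => quadraticChar F (d - x ^ 2) * g d]
        simp
      simp_rw [h1]
      rw [Finset.sum_comm]
      simp_rw [← Finset.sum_mul, sum_quadraticChar_sub_sq hF, mul_assoc, ← Finset.mul_sum]
      simp [sub_mul, Finset.sum_sub_distrib]
    rw [sum_pi_fin_succ_sq]
    simp_rw [fun x : F => ih fun c => g (x ^ 2 + c)]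
    rw [Finset.sum_add_distrib, ← Finset.mul_sum, ← Finset.mul_sum, h, sum_sum_sq_add]
    ring
  induction k with
  | zero =>
    refine ⟨fun g => ?_, even_of_odd 0 fun g => ?_⟩ <;>
    · rw [sum_pi_fin_succ_sq]
      simp [sum_comp_sq hF, add_mul, Finset.sum_add_distrib]
  | succ k ih =>
    have odd_case : ∀ g : F → ℤ, ∑ w : Fin (2 * (k + 1) + 1) → F, g (∑ i, w i ^ 2) =
        Fintype.card F ^ (2 * (k + 1)) * ∑ c : F, g c +
          Fintype.card F ^ (k + 1) * quadraticChar F (-1) ^ (k + 1) *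
            ∑ c : F, quadraticChar F c * g c := by
      intro g
      rw [sum_pi_fin_succ_sq, show 2 * (k + 1) = 2 * k + 2 by ring]
      simp_rw [fun x : F => ih.2 fun c => g (x ^ 2 + c)]
      rw [Finset.sum_add_distrib, ← Finset.mul_sum, ← Finset.mul_sum, Finset.sum_sub_distrib,
        ← Finset.mul_sum, sum_sum_sq_add]
      simp only [add_zero]
      rw [sum_comp_sq hF]
      simp only [add_mul, one_mul, Finset.sum_add_distrib]
      ring
    exact ⟨odd_case, even_of_odd _ odd_case⟩

/-- Twice the indicator function of the squares. -/
def squareWeight (x : F) : ℤ :=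
  1 + quadraticChar F x + if x = 0 then 1 else 0

theorem squareWeight_eq (x : F) [Decidable (IsSquare x)] :
    squareWeight x = 2 * if IsSquare x then 1 else 0 := by
  unfold squareWeight
  by_cases hx : x = 0
  · simp [hx]
  · by_cases hs : IsSquare x
    · simp [hx, hs, (quadraticChar_one_iff_isSquare hx).2 hs]
    · simp [hx, hs, quadraticChar_neg_one_iff_not_isSquare.2 hs]

theorem sum_squareWeight (hF : ringChar F ≠ 2) :
    ∑ x : F, squareWeight x = Fintype.card F + 1 := by
  simp_rw [squareWeight, Finset.sum_add_distrib, quadraticChar_sum_zero hF]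
  simp

theorem sum_squareWeight_mul (hF : ringChar F ≠ 2) (g : F → ℤ) :
    ∑ x : F, squareWeight x * g x = ∑ x : F, g (x ^ 2) + g 0 := by
  simp [sum_comp_sq hF, squareWeight, add_mul, Finset.sum_add_distrib]

omit [DecidableEq F] in
/-- The squared distances to `0` and `1` determine the first coordinate and the squared length
of the remaining ones. -/
theorem sum_sum_squared_distances (hF : ringChar F ≠ 2) (h : F → F → ℤ) :
    ∑ t : F, ∑ c : F, h (t ^ 2 + c) ((t - 1) ^ 2 + c) = ∑ a : F, ∑ b : F, h a b := by
  have h2 : (2 : F) ≠ 0 := Ring.two_ne_zero hF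
  let φ : F × F ≃ F × F :=
    { toFun := fun p => (p.1 ^ 2 + p.2, (p.1 - 1) ^ 2 + p.2)
      invFun := fun p => ((p.1 - p.2 + 1) / 2, p.1 - ((p.1 - p.2 + 1) / 2) ^ 2)
      left_inv := fun p => by
        have : (p.1 ^ 2 + p.2 - ((p.1 - 1) ^ 2 + p.2) + 1) / 2 = p.1 := by
          field_simp
          ring
        simp only [this]
        simp
      right_inv := fun p => by
        ext
        · simp
        · simp only
          field_simp
          ring }
  simpa [Fintype.sum_prod_type, φ] using φ.sum_comp fun p => h p.1 p.2

theorem sum_squareWeight_squared_distances (hF : ringChar F ≠ 2) :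
    ∑ t : F, ∑ c : F, squareWeight (t ^ 2 + c) * squareWeight ((t - 1) ^ 2 + c) =
      (Fintype.card F + 1 : ℤ) ^ 2 := by
  rw [sum_sum_squared_distances hF fun a b => squareWeight a * squareWeight b]
  simp_rw [← Finset.mul_sum, ← Finset.sum_mul, sum_squareWeight hF]
  ring

theorem sum_quadraticChar_heron (hF : ringChar F ≠ 2) :
    ∑ x : F, ∑ y : F, quadraticChar F (4 * x ^ 2 - (x ^ 2 - y ^ 2 + 1) ^ 2) =
      quadraticChar F (-1) := by
  have h2 : (2 : F) ≠ 0 := Ring.two_ne_zero hF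
  let φ : F × F ≃ F × F :=
    { toFun := fun p => (p.1 + p.2, p.1 - p.2)
      invFun := fun p => ((p.1 + p.2) / 2, (p.1 - p.2) / 2)
      left_inv := fun p => by
        ext <;> simp only <;> field_simp <;> ring
      right_inv := fun p => by
        ext <;> simp only <;> field_simp <;> ring }
  have h := φ.sum_comp fun p => quadraticChar F (-1) *
    (quadraticChar F (p.1 ^ 2 - 1) * quadraticChar F (p.2 ^ 2 - 1))
  rw [Fintype.sum_prod_type, Fintype.sum_prod_type] at h
  simp_rw [← Finset.mul_sum, ← Finset.sum_mul, sum_quadraticChar_sq_sub hF] at h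
  have h' : ∀ x y : F, quadraticChar F (4 * x ^ 2 - (x ^ 2 - y ^ 2 + 1) ^ 2) =
      quadraticChar F (-1) * (quadraticChar F ((φ (x, y)).1 ^ 2 - 1) *
        quadraticChar F ((φ (x, y)).2 ^ 2 - 1)) := by
    intro x y
    rw [← map_mul, ← map_mul]
    congr 1
    simp only [φ, Equiv.coe_fn_mk]
    ring
  simp_rw [h', ← Finset.mul_sum, h]
  simp

theorem sum_quadraticChar_squareWeight (hF : ringChar F ≠ 2) :
    ∑ t : F, ∑ c : F, quadraticChar F c *
        (squareWeight (t ^ 2 + c) * squareWeight ((t - 1) ^ 2 + c)) =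
      2 * quadraticChar F (-1) * (Fintype.card F - 1) := by
  have h2 : (2 : F) ≠ 0 := Ring.two_ne_zero hF
  have hc : ∀ t c : F, quadraticChar F c = quadraticChar F
      (4 * (t ^ 2 + c) - ((t ^ 2 + c) - ((t - 1) ^ 2 + c) + 1) ^ 2) := by
    intro t c
    rw [show 4 * (t ^ 2 + c) - ((t ^ 2 + c) - ((t - 1) ^ 2 + c) + 1) ^ 2 = 2 ^ 2 * c by ring,
      map_mul, quadraticChar_sq_one' h2, one_mul]
  have edge : ∑ y : F, quadraticChar F (-(y ^ 2 - 1) ^ 2) =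
      quadraticChar F (-1) * (Fintype.card F - 2) := by
    have h : ∀ y : F, quadraticChar F (-(y ^ 2 - 1) ^ 2) =
        quadraticChar F (-1) * (1 - if y ^ 2 - 1 = 0 then 1 else 0) := by
      intro y
      rw [neg_eq_neg_one_mul, map_mul]
      split_ifs with hy
      · simp [hy]
      · simp [quadraticChar_sq_one' hy]
    have hs : ∑ y : F, (if y ^ 2 - 1 = 0 then 1 else 0 : ℤ) = 2 := by
      rw [sum_comp_sq hF fun c => if c - 1 = 0 then 1 else 0]
      simp [sub_eq_zero]
    simp_rw [h, ← Finset.mul_sum]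
    rw [Finset.sum_sub_distrib, hs]
    simp
  rw [Finset.sum_congr rfl fun t _ => Finset.sum_congr rfl fun c _ => by rw [hc t c],
    sum_sum_squared_distances hF fun a b => quadraticChar F (4 * a - (a - b + 1) ^ 2) *
      (squareWeight a * squareWeight b)]
  have h : ∀ a b : F, quadraticChar F (4 * a - (a - b + 1) ^ 2) *
      (squareWeight a * squareWeight b) =
      squareWeight a * (squareWeight b * quadraticChar F (4 * a - (a - b + 1) ^ 2)) :=
    fun a b => by ring
  simp_rw [h, ← Finset.mul_sum, sum_squareWeight_mul hF]
  rw [Finset.sum_add_distrib, sum_quadraticChar_heron hF]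
  have e1 : ∀ x : F, 4 * x ^ 2 - (x ^ 2 - 0 + 1) ^ 2 = -(x ^ 2 - 1) ^ 2 := fun x => by ring
  have e2 : ∀ x : F, 4 * 0 - (0 - x ^ 2 + 1) ^ 2 = -(x ^ 2 - 1) ^ 2 := fun x => by ring
  simp_rw [e1, e2, edge]
  norm_num
  ring

theorem quadraticChar_neg_one_eq_pow (hF : Odd (Fintype.card F)) :
    quadraticChar F (-1) = (-1) ^ ((Fintype.card F - 1) / 2) := by
  have hF' : ringChar F ≠ 2 := by
    intro h
    have := FiniteField.even_card_of_char_two h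
    have := Nat.odd_iff.1 hF
    omega
  rw [quadraticChar_neg_one hF', ZMod.χ₄_eq_neg_one_pow (Nat.odd_iff.1 hF)]
  congr 1
  have := Nat.odd_iff.1 hF
  omega

end QuadraticSums

theorem card_common_neighbors_eq_sum (F : Type) [Field F] [Fintype F] [DecidableEq F]
    (n : ℕ) :
    4 * ((Nat.card {v : Fin (n + 1) → F // v ≠ 0 ∧ v ≠ unitVec F (n + 1) ∧
        IsSquare (∑ i, (v i) ^ 2) ∧
        IsSquare (∑ i, (v i - unitVec F (n + 1) i) ^ 2)} : ℤ) + 2) =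
      ∑ t : F, ∑ w : Fin n → F, squareWeight (t ^ 2 + ∑ i, w i ^ 2) *
        squareWeight ((t - 1) ^ 2 + ∑ i, w i ^ 2) := by
  classical
  let S : Finset (Fin (n + 1) → F) := {v | IsSquare (∑ i, (v i) ^ 2) ∧
    IsSquare (∑ i, (v i - unitVec F (n + 1) i) ^ 2)}
  have hu : ∑ i, unitVec F (n + 1) i ^ 2 = 1 := by
    simp [unitVec]
  have h0 : 0 ∈ S := by simp [S, hu]
  have h1 : unitVec F (n + 1) ∈ S.erase 0 := by
    have : unitVec F (n + 1) ≠ 0 := fun h => by simp [h] at hu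
    simp [S, hu, this]
  have hcard : Nat.card {v : Fin (n + 1) → F // v ≠ 0 ∧ v ≠ unitVec F (n + 1) ∧
      IsSquare (∑ i, (v i) ^ 2) ∧
      IsSquare (∑ i, (v i - unitVec F (n + 1) i) ^ 2)} + 2 = S.card := by
    rw [← Finset.card_erase_add_one h0, ← Finset.card_erase_add_one h1,
      Nat.subtype_card ((S.erase 0).erase (unitVec F (n + 1))) fun v => by simp [S]; tauto]
  have hsum : 4 * (S.card : ℤ) = ∑ v : Fin (n + 1) → F, squareWeight (∑ i, (v i) ^ 2) *
      squareWeight (∑ i, (v i - unitVec F (n + 1) i) ^ 2) := by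
    simp only [squareWeight_eq, S, Finset.card_filter, Nat.cast_sum, Finset.mul_sum]
    refine Finset.sum_congr rfl fun v _ => ?_
    split_ifs <;> simp_all
  have hcard' := congrArg (Nat.cast : ℕ → ℤ) hcard
  push_cast at hcard'
  rw [hcard', hsum, ← (Fin.consEquiv fun _ : Fin (n + 1) => F).sum_comp, Fintype.sum_prod_type]
  simp [Fin.consEquiv, Fin.sum_univ_succ, unitVec]

/-- The number `A(m,q)` of common neighbors of `0` and `e⁽¹⁾` in the
graph of integral distances on `F_q^m`. -/
theorem count_common_neighbors (q m : ℕ) (hq : IsPrimePow q) (hodd : Odd q) (hm : 2 ≤ m)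
    (F : Type) [Field F] [Fintype F] (hcard : Fintype.card F = q) :
    (Odd m → (Nat.card {v : Fin m → F // v ≠ 0 ∧ v ≠ unitVec F m ∧
        IsSquare (∑ i, (v i) ^ 2) ∧
        IsSquare (∑ i, (v i - unitVec F m i) ^ 2)} : ℚ) =
      ((q : ℚ) ^ (m - 2) * ((q : ℚ) + 1) ^ 2 +
        (-1 : ℚ) ^ (((m - 1) / 2) * ((q - 1) / 2)) * (q : ℚ) ^ ((m - 3) / 2) *
          (3 * (q : ℚ) ^ 2 - 2 * (q : ℚ) - 1)) / 4 - 2) ∧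
    (Even m → (Nat.card {v : Fin m → F // v ≠ 0 ∧ v ≠ unitVec F m ∧
        IsSquare (∑ i, (v i) ^ 2) ∧
        IsSquare (∑ i, (v i - unitVec F m i) ^ 2)} : ℚ) =
      ((q : ℚ) ^ (m - 2) * ((q : ℚ) + 1) ^ 2 +
        2 * (-1 : ℚ) ^ ((m / 2) * ((q - 1) / 2)) * (q : ℚ) ^ ((m - 2) / 2) *
          ((q : ℚ) - 1)) / 4 - 2) := by
  classical
  subst hcard
  have hF : ringChar F ≠ 2 := fun h =>
    Nat.not_even_iff_odd.2 hodd (Nat.even_iff.2 (FiniteField.even_card_of_char_two h))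
  obtain ⟨n, rfl⟩ : ∃ n, m = n + 1 := ⟨m - 1, by omega⟩
  have key := card_common_neighbors_eq_sum F n
  constructor
  · rintro ⟨k, hk⟩
    obtain ⟨k, rfl⟩ : ∃ j, k = j + 1 := ⟨k - 1, by omega⟩
    obtain rfl : n = 2 * k + 2 := by omega
    simp_rw [fun t : F => (sum_comp_sum_sq hF k).2
      fun c => squareWeight (t ^ 2 + c) * squareWeight ((t - 1) ^ 2 + c)] at key
    have hsq : ∀ t : F, squareWeight (t ^ 2) = 2 := fun t => by
      rw [squareWeight_eq, if_pos (IsSquare.sq t), mul_one]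
    rw [Finset.sum_add_distrib, ← Finset.mul_sum, ← Finset.mul_sum, Finset.sum_sub_distrib,
      ← Finset.mul_sum, sum_squareWeight_squared_distances hF,
      quadraticChar_neg_one_eq_pow hodd] at key
    simp only [add_zero, hsq, Finset.sum_const, Finset.card_univ, nsmul_eq_mul, ← pow_mul] at key
    rw [show 2 * k + 2 + 1 - 2 = 2 * k + 1 by omega, show (2 * k + 2 + 1 - 1) / 2 = k + 1 by omega,
      show (2 * k + 2 + 1 - 3) / 2 = k by omega, mul_comm (k + 1)]
    have key' := congrArg (Int.cast : ℤ → ℚ) key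
    push_cast at key'
    linear_combination key' / 4
  · rintro ⟨k, hk⟩
    obtain ⟨k, rfl⟩ : ∃ j, k = j + 1 := ⟨k - 1, by omega⟩
    obtain rfl : n = 2 * k + 1 := by omega
    simp_rw [fun t : F => (sum_comp_sum_sq hF k).1
      fun c => squareWeight (t ^ 2 + c) * squareWeight ((t - 1) ^ 2 + c)] at key
    rw [Finset.sum_add_distrib, ← Finset.mul_sum, ← Finset.mul_sum,
      sum_squareWeight_squared_distances hF, sum_quadraticChar_squareWeight hF,
      quadraticChar_neg_one_eq_pow hodd] at key
    rw [show 2 * k + 1 + 1 - 2 = 2 * k by omega, show (2 * k + 1 + 1) / 2 = k + 1 by omega,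
      show 2 * k / 2 = k by omega, mul_comm (k + 1), pow_mul, pow_succ]
    have key' := congrArg (Int.cast : ℤ → ℚ) key
    push_cast at key'
    linear_combination key' / 4
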